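/- Let k ∈ ℂ with Re(k) < 0, let m ∈ ℕ with m < |Re(k)|/2, and let f : ℚ → ℂ be 1-periodic (f(x+1) = f(x) for all x ∈ ℚ) and satisfy f(x) − |x|^{−k}·f(−1/x) = h(x) for all x ∈ ℚ\{0}, where h : [−1,1] → ℂ is m times continuously differentiable on [−1,1] and h(0) = f(0). Then the function f† : ℝ → ℂ, equal to f on ℚ and to lim_{ℚ∋y→x} f(y) at irrational x (this limit exists), is m times continuously differentiable on all of ℝ. -/

import Mathlib

open Filter Topology MeasureTheory Set

/-- The action `x ↦ |x| ^ κ * F (-1 / x)` of the inversion on functions of weight `-κ`. -/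
noncomputable def inversionSlash (κ : ℂ) (F : ℝ → ℂ) (x : ℝ) : ℂ :=
  ((|x| : ℝ) : ℂ) ^ κ * F (-x⁻¹)

lemma norm_abs_cpow {κ : ℂ} (hκ : 0 < κ.re) (x : ℝ) :
    ‖((|x| : ℝ) : ℂ) ^ κ‖ = |x| ^ κ.re :=
  Complex.norm_cpow_eq_rpow_re_of_nonneg (abs_nonneg x) hκ.ne'

lemma norm_inversionSlash_le {κ : ℂ} (hκ : 0 < κ.re) {F : ℝ → ℂ} {B : ℝ}
    (hB : ∀ x, ‖F x‖ ≤ B) (x : ℝ) : ‖inversionSlash κ F x‖ ≤ |x| ^ κ.re * B := by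
  rw [inversionSlash, norm_mul, norm_abs_cpow hκ]
  gcongr
  exact hB _

lemma inversionSlash_zero {κ : ℂ} (hκ : 0 < κ.re) (F : ℝ → ℂ) : inversionSlash κ F 0 = 0 := by
  have : κ ≠ 0 := by rintro rfl; simp at hκ
  simp [inversionSlash, this]

lemma abs_cpow_eq_mul_sq {x : ℝ} (hx : x ≠ 0) (κ : ℂ) :
    ((|x| : ℝ) : ℂ) ^ κ = ((|x| : ℝ) : ℂ) ^ (κ - 2) * (x : ℂ) ^ 2 := by
  have h : ((|x| : ℝ) : ℂ) ≠ 0 := by simpa using hx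
  have h2 : ((|x| : ℝ) : ℂ) ^ 2 = (x : ℂ) ^ 2 := by exact_mod_cast sq_abs x
  rw [← h2, ← Complex.cpow_natCast, ← Complex.cpow_add _ _ h]
  simp

lemma hasDerivAt_abs_cpow {x : ℝ} (hx : x ≠ 0) (κ : ℂ) :
    HasDerivAt (fun y : ℝ => ((|y| : ℝ) : ℂ) ^ κ)
      (κ * (x * ((|x| : ℝ) : ℂ) ^ (κ - 2))) x := by
  have hexp : ∀ y : ℝ, y ≠ 0 → ((|y| : ℝ) : ℂ) ^ κ = Complex.exp ((Real.log y : ℂ) * κ) := by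
    intro y hy
    have h : ((|y| : ℝ) : ℂ) ≠ 0 := by simpa using hy
    rw [Complex.cpow_def_of_ne_zero h, ← Complex.ofReal_log (abs_nonneg y), Real.log_abs]
  have hd := (((Real.hasDerivAt_log hx).ofReal_comp).mul_const κ).cexp
  refine (hd.congr_of_eventuallyEq ?_).congr_deriv ?_
  · filter_upwards [isOpen_ne.mem_nhds hx] with y hy using hexp y hy
  · rw [← hexp x hx, abs_cpow_eq_mul_sq hx κ]
    have : (x : ℂ) ≠ 0 := by exact_mod_cast hx
    push_cast
    field_simp

lemma tendsto_inversionSlash_zero {κ : ℂ} (hκ : 0 < κ.re) {F : ℝ → ℂ} {B : ℝ}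
    (hB : ∀ x, ‖F x‖ ≤ B) : Tendsto (inversionSlash κ F) (𝓝 0) (𝓝 0) := by
  refine squeeze_zero_norm (norm_inversionSlash_le hκ hB) ?_
  have : Continuous fun x : ℝ => |x| ^ κ.re * B :=
    (continuous_abs.rpow_const fun _ => Or.inr hκ.le).mul continuous_const
  simpa [Real.zero_rpow hκ.ne'] using this.tendsto 0

lemma continuousAt_abs_cpow {x : ℝ} (hx : x ≠ 0) (κ : ℂ) :
    ContinuousAt (fun y : ℝ => ((|y| : ℝ) : ℂ) ^ κ) x :=
  (hasDerivAt_abs_cpow hx κ).continuousAt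

lemma continuous_inversionSlash {κ : ℂ} (hκ : 0 < κ.re) {F : ℝ → ℂ} (hF : Continuous F) {B : ℝ}
    (hB : ∀ x, ‖F x‖ ≤ B) : Continuous (inversionSlash κ F) := by
  rw [continuous_iff_continuousAt]
  intro x
  rcases eq_or_ne x 0 with rfl | hx
  · rw [ContinuousAt, inversionSlash_zero hκ]
    exact tendsto_inversionSlash_zero hκ hB
  · exact (continuousAt_abs_cpow hx κ).mul
      (hF.continuousAt.comp (continuousAt_inv₀ hx).neg)

lemma exists_norm_le_of_periodic {F : ℝ → ℂ} (hF : Continuous F) (hper : F.Periodic 1) :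
    ∃ B, ∀ x, ‖F x‖ ≤ B := by
  obtain ⟨B, hB⟩ := (hper.isBounded_of_continuous one_ne_zero hF).exists_norm_le
  exact ⟨B, fun x => hB _ (mem_range_self x)⟩

lemma hasDerivAt_inversionSlash {κ : ℂ} (hκ : 2 < κ.re) {F : ℝ → ℂ} {B : ℝ}
    (hB : ∀ x, ‖F x‖ ≤ B) (hF : Differentiable ℝ F) (x : ℝ) :
    HasDerivAt (inversionSlash κ F)
      (κ * (x * inversionSlash (κ - 2) F x) + inversionSlash (κ - 2) (deriv F) x) x := by
  have hκ2 : 0 < (κ - 2).re := by simpa using hκ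
  rcases eq_or_ne x 0 with rfl | hx
  · rw [inversionSlash_zero hκ2, inversionSlash_zero hκ2, hasDerivAt_iff_tendsto_slope]
    have hlim : Tendsto (fun y : ℝ => (y : ℂ) * inversionSlash (κ - 2) F y) (𝓝[≠] 0)
        (𝓝 (((0 : ℝ) : ℂ) * 0)) :=
      ((Complex.continuous_ofReal.tendsto 0).mul
        (tendsto_inversionSlash_zero hκ2 hB)).mono_left nhdsWithin_le_nhds
    have h0 : κ * (((0 : ℝ) : ℂ) * 0) + 0 = ((0 : ℝ) : ℂ) * 0 := by simp
    rw [h0]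
    refine hlim.congr' ?_
    filter_upwards [self_mem_nhdsWithin] with y hy
    have hy0 : (y : ℂ) ≠ 0 := by exact_mod_cast hy
    rw [slope_def_module, inversionSlash_zero (by linarith), inversionSlash, inversionSlash,
      abs_cpow_eq_mul_sq hy κ, Complex.real_smul]
    push_cast
    field_simp
    ring_nf
  · have h1 := (hasDerivAt_abs_cpow hx κ).mul
      ((hF (-x⁻¹)).hasDerivAt.scomp x (hasDerivAt_inv hx).neg)
    refine h1.congr_deriv ?_
    have hx0 : (x : ℂ) ≠ 0 := by exact_mod_cast hx
    simp only [inversionSlash, abs_cpow_eq_mul_sq hx κ, Complex.real_smul]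
    push_cast
    field_simp
    simp

lemma deriv_periodic {F : ℝ → ℂ} (hper : F.Periodic 1) : (deriv F).Periodic 1 := by
  intro x
  have : (fun y => F (y + 1)) = F := funext hper
  rw [← deriv_comp_add_const, this]

lemma contDiff_inversionSlash (j : ℕ) : ∀ {κ : ℂ} {F : ℝ → ℂ}, 2 * (j : ℝ) < κ.re →
    ContDiff ℝ j F → F.Periodic 1 → ContDiff ℝ j (inversionSlash κ F) := by
  induction j with
  | zero =>
    intro κ F hκ hF hper
    rw [Nat.cast_zero, contDiff_zero] at hF ⊢
    obtain ⟨B, hB⟩ := exists_norm_le_of_periodic hF hper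
    exact continuous_inversionSlash (by simpa using hκ) hF hB
  | succ j ih =>
    intro κ F hκ hF hper
    obtain ⟨B, hB⟩ := exists_norm_le_of_periodic hF.continuous hper
    push_cast at hκ hF ⊢
    have hj : (0 : ℝ) ≤ j := j.cast_nonneg
    have hκ2 : 2 * (j : ℝ) < (κ - 2).re := by
      simp only [Complex.sub_re, Complex.re_ofNat]; linarith
    obtain ⟨hdiff, -, hder⟩ := contDiff_succ_iff_deriv.1 hF
    have hd := hasDerivAt_inversionSlash (κ := κ) (by linarith) hB hdiff
    refine contDiff_succ_iff_deriv.2 ⟨fun x => (hd x).differentiableAt, by simp, ?_⟩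
    rw [funext fun x => (hd x).deriv]
    have hFj : ContDiff ℝ j F := hF.of_le (by simp)
    exact (contDiff_const.mul (Complex.ofRealCLM.contDiff.mul (ih hκ2 hFj hper))).add
      (ih hκ2 hder (deriv_periodic hper))

lemma norm_inversionSlash_sub_le {κ : ℂ} (hκ : 2 < κ.re) {F : ℝ → ℂ} {B : ℝ}
    (hB : ∀ x, ‖F x‖ ≤ B) {δ C L : ℝ} (hδ : 0 < δ) (hC0 : 0 ≤ C) (hL0 : 0 ≤ L)
    (hC : ∀ y z : ℝ, |y| ≤ δ → |z| ≤ δ →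
      ‖((|y| : ℝ) : ℂ) ^ κ - ((|z| : ℝ) : ℂ) ^ κ‖ ≤ C * |y - z|)
    {y z : ℝ} (hy : |y| ≤ δ) (hz : |z| ≤ δ)
    (hL : 0 < y * z → ‖F (-y⁻¹) - F (-z⁻¹)‖ ≤ L * |(-y⁻¹) - (-z⁻¹)|) :
    ‖inversionSlash κ F y - inversionSlash κ F z‖ ≤
      (C * B + δ ^ (κ.re - 1) * B + δ ^ (κ.re - 2) * L) * |y - z| := by
  wlog hzy : |z| ≤ |y| generalizing y z
  · rw [norm_sub_rev, abs_sub_comm]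
    refine this hz hy (fun h => ?_) (le_of_not_ge hzy)
    rw [norm_sub_rev, abs_sub_comm]
    exact hL (by linarith)
  have hB0 : 0 ≤ B := (norm_nonneg _).trans (hB 0)
  have hδ1 : 0 ≤ δ ^ (κ.re - 1) := by positivity
  have hδ2 : 0 ≤ δ ^ (κ.re - 2) := by positivity
  rcases lt_or_ge 0 (y * z) with hyz | hyz
  · have hy0 : y ≠ 0 := by rintro rfl; simp at hyz
    have hz0 : z ≠ 0 := by rintro rfl; simp at hyz
    have hzpos : 0 < |z| := abs_pos.2 hz0
    have hypos : 0 < |y| := abs_pos.2 hy0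
    have hsplit : inversionSlash κ F y - inversionSlash κ F z =
        (((|y| : ℝ) : ℂ) ^ κ - ((|z| : ℝ) : ℂ) ^ κ) * F (-y⁻¹) +
          ((|z| : ℝ) : ℂ) ^ κ * (F (-y⁻¹) - F (-z⁻¹)) := by
      simp only [inversionSlash]; ring
    have hinv : |(-y⁻¹) - (-z⁻¹)| = |y - z| / (|y| * |z|) := by
      rw [← abs_mul, ← abs_div]
      congr 1
      field_simp
      ring
    have h1 : ‖(((|y| : ℝ) : ℂ) ^ κ - ((|z| : ℝ) : ℂ) ^ κ) * F (-y⁻¹)‖ ≤ C * |y - z| * B := by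
      rw [norm_mul]
      exact mul_le_mul (hC y z hy hz) (hB _) (norm_nonneg _) (by positivity)
    have h2 : ‖((|z| : ℝ) : ℂ) ^ κ * (F (-y⁻¹) - F (-z⁻¹))‖ ≤
        δ ^ (κ.re - 2) * L * |y - z| := by
      rw [norm_mul, norm_abs_cpow (by linarith)]
      have hpow : |z| ^ κ.re = |z| ^ (κ.re - 2) * (|z| * |z|) := by
        rw [← sq, ← Real.rpow_natCast, ← Real.rpow_add hzpos]
        simp
      calc |z| ^ κ.re * ‖F (-y⁻¹) - F (-z⁻¹)‖
          ≤ |z| ^ κ.re * (L * (|y - z| / (|y| * |z|))) := by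
            gcongr
            rw [← hinv]
            exact hL hyz
        _ = |z| ^ (κ.re - 2) * L * |y - z| * (|z| / |y|) := by
            rw [hpow]
            field_simp
        _ ≤ |z| ^ (κ.re - 2) * L * |y - z| * 1 := by
            gcongr
            exact (div_le_one hypos).2 hzy
        _ ≤ δ ^ (κ.re - 2) * L * |y - z| := by
            rw [mul_one]
            gcongr
    rw [hsplit]
    refine (norm_add_le _ _).trans ((add_le_add h1 h2).trans ?_)
    have : 0 ≤ δ ^ (κ.re - 1) * B * |y - z| := by positivity
    nlinarith
  · have habs : |y - z| = |y| + |z| := by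
      rcases abs_cases y with ⟨h1, h1'⟩ | ⟨h1, h1'⟩ <;>
      rcases abs_cases z with ⟨h2, h2'⟩ | ⟨h2, h2'⟩ <;>
      rcases abs_cases (y - z) with ⟨h3, h3'⟩ | ⟨h3, h3'⟩ <;>
      rw [h1, h2, h3] <;> nlinarith
    have hle : ∀ w : ℝ, |w| ≤ δ → ‖inversionSlash κ F w‖ ≤ δ ^ (κ.re - 1) * B * |w| := by
      intro w hw
      refine (norm_inversionSlash_le (by linarith) hB w).trans ?_
      have : |w| ^ κ.re = |w| ^ (κ.re - 1) * |w| := by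
        nth_rewrite 3 [← Real.rpow_one |w|]
        rw [← Real.rpow_add_of_nonneg (abs_nonneg w) (by linarith) zero_le_one]
        simp
      rw [this]
      have := Real.rpow_le_rpow (abs_nonneg w) hw (show 0 ≤ κ.re - 1 by linarith)
      calc _ = |w| ^ (κ.re - 1) * B * |w| := by ring
        _ ≤ _ := by gcongr
    refine (norm_sub_le _ _).trans ((add_le_add (hle y hy) (hle z hz)).trans ?_)
    rw [habs]
    have : 0 ≤ (C * B + δ ^ (κ.re - 2) * L) * (|y| + |z|) := by positivity
    nlinarith

lemma contDiff_abs_cpow {κ : ℂ} (hκ : 2 < κ.re) :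
    ContDiff ℝ 1 (fun x : ℝ => ((|x| : ℝ) : ℂ) ^ κ) := by
  have h := contDiff_inversionSlash 1 (κ := κ) (F := fun _ => 1) (by simpa using hκ)
    contDiff_const (fun _ => rfl)
  have heq : inversionSlash κ (fun _ => 1) = fun x : ℝ => ((|x| : ℝ) : ℂ) ^ κ := by
    funext x
    simp [inversionSlash]
  simpa [heq] using h

lemma exists_lipschitz_of_contDiffOn {κ : ℂ} (hκ : 2 < κ.re) {F : ℝ → ℂ} (hF : Continuous F)
    (hper : F.Periodic 1)
    (hreg : ContDiffOn ℝ 1 (fun x => F x - inversionSlash κ F x) (Ioo (-1) 1)) :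
    ∃ L, 0 ≤ L ∧ ∀ y z, ‖F y - F z‖ ≤ L * |y - z| := by
  obtain ⟨B, hB⟩ := exists_norm_le_of_periodic hF hper
  have hB0 : 0 ≤ B := (norm_nonneg _).trans (hB 0)
  have hsub : Icc (-(3 / 4) : ℝ) (3 / 4) ⊆ Ioo (-1) 1 := fun x hx =>
    ⟨by linarith [hx.1], by linarith [hx.2]⟩
  obtain ⟨CH, hCH⟩ := (hreg.mono hsub).exists_lipschitzOnWith one_ne_zero
    (convex_Icc _ _) isCompact_Icc
  obtain ⟨CP, hCP⟩ := (contDiff_abs_cpow hκ).contDiffOn.exists_lipschitzOnWith one_ne_zero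
    (convex_Icc (-(3 / 4) : ℝ) (3 / 4)) isCompact_Icc
  set ρ : ℝ := (3 / 4 : ℝ) ^ (κ.re - 2) with hρ
  have hρ0 : 0 ≤ ρ := by positivity
  have hρ1 : ρ < 1 := Real.rpow_lt_one (by norm_num) (by norm_num) (by linarith)
  set K : ℝ := CH + (CP * B + (3 / 4 : ℝ) ^ (κ.re - 1) * B) with hK
  set L : ℝ := max (8 * B) (K / (1 - ρ)) with hL
  have hL8 : 8 * B ≤ L := le_max_left _ _
  have hL0 : 0 ≤ L := by linarith
  have hLK : K + ρ * L ≤ L := by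
    have : K / (1 - ρ) ≤ L := le_max_right _ _
    rw [div_le_iff₀ (by linarith)] at this
    linarith
  have key : ∀ n : ℕ, ∀ y z : ℝ, (9 / 16 : ℝ) ^ n / 4 ≤ |y - z| → ‖F y - F z‖ ≤ L * |y - z| := by
    have hlarge : ∀ y z : ℝ, 1 / 4 ≤ |y - z| → ‖F y - F z‖ ≤ L * |y - z| := by
      intro y z h
      have := norm_sub_le_of_le (hB y) (hB z)
      nlinarith
    intro n
    induction n with
    | zero => intro y z h; exact hlarge y z (by simpa using h)
    | succ n ih =>
      have hsmall : ∀ y z : ℝ, |y| ≤ 3 / 4 → |z| ≤ 3 / 4 → (9 / 16 : ℝ) ^ (n + 1) / 4 ≤ |y - z| →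
          ‖F y - F z‖ ≤ L * |y - z| := by
        intro y z hy hz h
        have h1 := hCH.dist_le_mul y (abs_le.1 hy) z (abs_le.1 hz)
        rw [dist_eq_norm, Real.dist_eq] at h1
        have h2 := norm_inversionSlash_sub_le hκ hB (δ := 3 / 4) (C := CP) (L := L) (by norm_num)
          CP.2 hL0 (fun y z hy hz => by
            simpa [dist_eq_norm, Real.dist_eq] using
              hCP.dist_le_mul y (abs_le.1 hy) z (abs_le.1 hz)) hy hz
          (fun hyz => by
            refine ih _ _ ?_
            have hy0 : y ≠ 0 := by rintro rfl; simp at hyz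
            have hz0 : z ≠ 0 := by rintro rfl; simp at hyz
            have hinv : |(-y⁻¹) - (-z⁻¹)| = |y - z| / |y * z| := by
              rw [← abs_div]
              congr 1
              field_simp
              ring
            rw [hinv, le_div_iff₀ (abs_pos.2 hyz.ne')]
            have : |y * z| ≤ 9 / 16 := by
              rw [abs_mul]
              nlinarith [abs_nonneg y, abs_nonneg z]
            have hp : 0 ≤ (9 / 16 : ℝ) ^ n := by positivity
            rw [pow_succ] at h
            nlinarith)
        have hsplit : F y - F z = ((F y - inversionSlash κ F y) - (F z - inversionSlash κ F z)) +
            (inversionSlash κ F y - inversionSlash κ F z) := by ring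
        rw [hsplit]
        refine (norm_add_le _ _).trans ((add_le_add h1 h2).trans ?_)
        rw [← add_mul]
        gcongr
        linarith
      intro y z h
      rcases le_or_gt (1 / 4) |y - z| with h4 | h4
      · exact hlarge y z h4
      · have hr := abs_le.1 (abs_sub_round ((y + z) / 2))
        have hlt := abs_lt.1 h4
        have hshift : ∀ w, F (w - round ((y + z) / 2)) = F w := fun w => by
          simpa using hper.sub_int_mul_eq (x := w) (round ((y + z) / 2))
        have := hsmall (y - round ((y + z) / 2)) (z - round ((y + z) / 2))
          (abs_le.2 ⟨by linarith, by linarith⟩) (abs_le.2 ⟨by linarith, by linarith⟩)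
          (by simpa using h)
        simpa [hshift] using this
  refine ⟨L, hL0, fun y z => ?_⟩
  rcases eq_or_ne y z with rfl | hne
  · simp
  · have hpos : 0 < 4 * |y - z| := by have := abs_pos.2 (sub_ne_zero.2 hne); linarith
    obtain ⟨n, hn⟩ := exists_pow_lt_of_lt_one hpos (show (9 / 16 : ℝ) < 1 by norm_num)
    exact key n y z (by linarith)

/-- Near `(x, x)`, the difference quotients of `F` lie within `c` of a common value. -/
def StrictDerivApprox (F : ℝ → ℂ) (x c : ℝ) : Prop :=
  ∃ a : ℂ, ∀ᶠ p : ℝ × ℝ in 𝓝 (x, x),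
    ‖F p.1 - F p.2 - ((p.1 - p.2 : ℝ) : ℂ) * a‖ ≤ c * |p.1 - p.2|

lemma HasStrictDerivAt.eventually_norm_sub_le {F : ℝ → ℂ} {a : ℂ} {x : ℝ}
    (hF : HasStrictDerivAt F a x) {c : ℝ} (hc : 0 < c) :
    ∀ᶠ p : ℝ × ℝ in 𝓝 (x, x),
      ‖F p.1 - F p.2 - ((p.1 - p.2 : ℝ) : ℂ) * a‖ ≤ c * |p.1 - p.2| := by
  have h := (hasStrictFDerivAt_iff_isLittleO.1 hF.hasStrictFDerivAt).def hc
  filter_upwards [h] with p hp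
  simpa [Complex.real_smul] using hp

lemma StrictDerivApprox.add {F G : ℝ → ℂ} {x c c' : ℝ} (hF : StrictDerivApprox F x c)
    (hG : StrictDerivApprox G x c') : StrictDerivApprox (fun y => F y + G y) x (c + c') := by
  obtain ⟨a, ha⟩ := hF
  obtain ⟨b, hb⟩ := hG
  refine ⟨a + b, ?_⟩
  filter_upwards [ha, hb] with p h1 h2
  rw [add_mul]
  refine le_trans (le_of_eq ?_) ((norm_add_le _ _).trans (add_le_add h1 h2))
  congr 1
  ring

lemma strictDerivApprox_zero {κ : ℂ} (hκ : 2 < κ.re) {F : ℝ → ℂ} {B L : ℝ}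
    (hB : ∀ x, ‖F x‖ ≤ B) (hL0 : 0 ≤ L) (hL : ∀ y z, ‖F y - F z‖ ≤ L * |y - z|)
    (hreg : ContDiffAt ℝ 1 (fun x => F x - inversionSlash κ F x) 0) {c : ℝ} (hc : 0 < c) :
    StrictDerivApprox F 0 c := by
  have hB0 : 0 ≤ B := (norm_nonneg _).trans (hB 0)
  have hp : HasStrictDerivAt (fun x : ℝ => ((|x| : ℝ) : ℂ) ^ κ) 0 0 := by
    have h := (contDiff_abs_cpow hκ).contDiffAt.hasStrictDerivAt (x := 0) one_ne_zero
    have h0 := (hasDerivAt_inversionSlash hκ (F := fun _ => 1) (B := 1) (by simp)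
      (differentiable_const _) 0).deriv
    have hz : (fun x : ℝ => ((|x| : ℝ) : ℂ) ^ κ) = inversionSlash κ fun _ => 1 := by
      funext x; simp [inversionSlash]
    rw [hz] at h ⊢
    rw [h0] at h
    simpa [inversionSlash_zero (κ := κ - 2) (by simpa using hκ)] using h
  obtain ⟨ε, hε, hεB⟩ : ∃ ε : ℝ, 0 < ε ∧ ε * B ≤ c / 4 := by
    refine ⟨c / 4 / (B + 1), by positivity, ?_⟩
    rw [div_mul_eq_mul_div, div_le_iff₀ (by linarith)]
    nlinarith
  obtain ⟨r, hr, hrp⟩ := Metric.eventually_nhds_iff.1 (hp.eventually_norm_sub_le hε)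
  have hcont : Tendsto (fun δ : ℝ => δ ^ (κ.re - 1) * B + δ ^ (κ.re - 2) * L) (𝓝[>] 0) (𝓝 0) := by
    have h1 : Continuous fun δ : ℝ => δ ^ (κ.re - 1) * B + δ ^ (κ.re - 2) * L :=
      ((Real.continuous_rpow_const (by linarith)).mul continuous_const).add
        ((Real.continuous_rpow_const (by linarith)).mul continuous_const)
    have h2 := h1.tendsto 0
    rw [Real.zero_rpow (by linarith), Real.zero_rpow (by linarith)] at h2
    simpa using h2.mono_left nhdsWithin_le_nhds
  obtain ⟨δ, hδc, hδr, hδ0⟩ := ((hcont.eventually (gt_mem_nhds (show 0 < c / 4 by linarith))).and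
    ((eventually_lt_nhds hr).filter_mono nhdsWithin_le_nhds |>.and self_mem_nhdsWithin)).exists
  have hδ0 : 0 < δ := hδ0
  have hΨ : ∀ᶠ p : ℝ × ℝ in 𝓝 ((0 : ℝ), (0 : ℝ)),
      ‖inversionSlash κ F p.1 - inversionSlash κ F p.2 - ((p.1 - p.2 : ℝ) : ℂ) * 0‖ ≤
        c / 2 * |p.1 - p.2| := by
    filter_upwards [Metric.ball_mem_nhds ((0 : ℝ), (0 : ℝ)) hδ0] with p hpδ
    rw [Metric.mem_ball, Prod.dist_eq, max_lt_iff, Real.dist_eq, Real.dist_eq] at hpδ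
    simp only [sub_zero] at hpδ
    rw [mul_zero, sub_zero]
    refine (norm_inversionSlash_sub_le hκ hB hδ0 hε.le hL0 (fun y z hy hz => ?_) hpδ.1.le hpδ.2.le
      fun _ => hL _ _).trans ?_
    · have := hrp (y := (y, z)) (by
        rw [Prod.dist_eq, max_lt_iff, Real.dist_eq, Real.dist_eq]
        simp only [sub_zero]
        exact ⟨by linarith, by linarith⟩)
      simpa using this
    · gcongr
      linarith
  have hH : StrictDerivApprox (fun x => F x - inversionSlash κ F x) 0 (c / 2) :=
    ⟨_, (hreg.hasStrictDerivAt one_ne_zero).eventually_norm_sub_le (by linarith)⟩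
  have hΨ' : StrictDerivApprox (inversionSlash κ F) 0 (c / 2) := ⟨0, hΨ⟩
  have hsum := hH.add hΨ'
  simp only [sub_add_cancel] at hsum
  rwa [add_halves] at hsum

lemma strictDerivApprox_step {κ : ℂ} (hκ : 2 < κ.re) {F : ℝ → ℂ} (hF : Continuous F) {x c c' : ℝ}
    (hx : x ≠ 0) (hreg : ContDiffAt ℝ 1 (fun x => F x - inversionSlash κ F x) x)
    (hcc : |x| ^ (κ.re - 2) * c < c') (h : StrictDerivApprox F (-x⁻¹) c) :
    StrictDerivApprox F x c' := by
  obtain ⟨a, ha⟩ := h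
  set A : ℝ → ℂ := fun w => F (-x⁻¹) + ((w - -x⁻¹ : ℝ) : ℂ) * a with hA
  set K : ℝ → ℂ := fun y => (F y - inversionSlash κ F y) + ((|y| : ℝ) : ℂ) ^ κ * A (-y⁻¹) with hK
  set P : ℝ → ℂ := fun y => ((|y| : ℝ) : ℂ) ^ κ * (F (-y⁻¹) - A (-y⁻¹)) with hP
  have hAdiff : ContDiff ℝ 1 A :=
    contDiff_const.add ((Complex.ofRealCLM.contDiff.comp (contDiff_id.sub contDiff_const)).mul
      contDiff_const)
  have hpdiff := (contDiff_abs_cpow hκ).contDiffAt (x := x)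
  have hKdiff : ContDiffAt ℝ 1 K x :=
    hreg.add (hpdiff.mul (hAdiff.contDiffAt.comp x (contDiffAt_inv ℝ hx).neg))
  obtain ⟨ε, hε, hεc⟩ : ∃ ε > 0, |x| ^ (κ.re - 2) * c + ε < c' :=
    ⟨(c' - |x| ^ (κ.re - 2) * c) / 2, by linarith, by linarith⟩
  obtain ⟨Cp, s, hs, hCp⟩ := hpdiff.exists_lipschitzOnWith
  have hinv : ContinuousAt (fun y : ℝ => -y⁻¹) x := (continuousAt_inv₀ hx).neg
  have hinv2 : Tendsto (fun p : ℝ × ℝ => (-p.1⁻¹, -p.2⁻¹)) (𝓝 (x, x)) (𝓝 (-x⁻¹, -x⁻¹)) := by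
    rw [nhds_prod_eq, nhds_prod_eq]
    exact hinv.tendsto.prodMap hinv.tendsto
  have hfst : Tendsto (fun p : ℝ × ℝ => p.1) (𝓝 (x, x)) (𝓝 x) := continuous_fst.tendsto _
  have hsnd : Tendsto (fun p : ℝ × ℝ => p.2) (𝓝 (x, x)) (𝓝 x) := continuous_snd.tendsto _
  have hcoef : Tendsto (fun p : ℝ × ℝ => Cp * ‖F (-p.1⁻¹) - A (-p.1⁻¹)‖ +
      |p.2| ^ κ.re * c / |p.1 * p.2|) (𝓝 (x, x)) (𝓝 (|x| ^ (κ.re - 2) * c)) := by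
    have h1 : Tendsto (fun y : ℝ => ‖F (-y⁻¹) - A (-y⁻¹)‖) (𝓝 x) (𝓝 0) := by
      have := ((hF.sub hAdiff.continuous).continuousAt.comp hinv).norm.tendsto
      simpa [hA, Function.comp_def] using this
    have h2 : Tendsto (fun p : ℝ × ℝ => |p.2| ^ κ.re * c / |p.1 * p.2|) (𝓝 (x, x))
        (𝓝 (|x| ^ κ.re * c / |x * x|)) :=
      ((hsnd.abs.rpow_const (Or.inr (by linarith))).mul_const c).div (hfst.mul hsnd).abs
        (abs_ne_zero.2 (mul_ne_zero hx hx))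
    have hx2 : |x| ^ (κ.re - 2) * c = Cp * 0 + |x| ^ κ.re * c / |x * x| := by
      have hpos := abs_pos.2 hx
      have : |x| ^ κ.re = |x| ^ (κ.re - 2) * (|x| * |x|) := by
        rw [← sq, ← Real.rpow_natCast, ← Real.rpow_add hpos]
        simp
      rw [this, abs_mul]
      field_simp
      simp
    rw [hx2]
    exact ((h1.comp hfst).const_mul _).add h2
  have hPev : ∀ᶠ p : ℝ × ℝ in 𝓝 (x, x),
      ‖P p.1 - P p.2 - ((p.1 - p.2 : ℝ) : ℂ) * 0‖ ≤ (c' - ε) * |p.1 - p.2| := by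
    filter_upwards [hcoef.eventually (gt_mem_nhds (show _ < c' - ε by linarith)),
      hinv2.eventually ha, hfst.eventually hs, hsnd.eventually hs,
      hfst.eventually (isOpen_ne.mem_nhds hx), hsnd.eventually (isOpen_ne.mem_nhds hx)]
      with ⟨y, z⟩ hlt hap hys hzs hy0 hz0
    simp only at hlt hap hys hzs hy0 hz0 ⊢
    have hlip := hCp.dist_le_mul y hys z hzs
    rw [dist_eq_norm, Real.dist_eq] at hlip
    have hdist : |(-y⁻¹) - (-z⁻¹)| = |y - z| / |y * z| := by
      rw [← abs_div]
      congr 1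
      field_simp
      ring
    rw [hdist] at hap
    have hsplit : P y - P z - ((y - z : ℝ) : ℂ) * 0 =
        (((|y| : ℝ) : ℂ) ^ κ - ((|z| : ℝ) : ℂ) ^ κ) * (F (-y⁻¹) - A (-y⁻¹)) +
          ((|z| : ℝ) : ℂ) ^ κ *
            (F (-y⁻¹) - F (-z⁻¹) - (((-y⁻¹) - (-z⁻¹) : ℝ) : ℂ) * a) := by
      simp only [hP, hA]
      push_cast
      ring
    rw [hsplit]
    refine (norm_add_le _ _).trans ?_
    rw [norm_mul, norm_mul, norm_abs_cpow (by linarith)]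
    calc _ ≤ Cp * |y - z| * ‖F (-y⁻¹) - A (-y⁻¹)‖ +
          |z| ^ κ.re * (c * (|y - z| / |y * z|)) := by gcongr
      _ = (Cp * ‖F (-y⁻¹) - A (-y⁻¹)‖ + |z| ^ κ.re * c / |y * z|) * |y - z| := by ring
      _ ≤ (c' - ε) * |y - z| := by gcongr
  have hKapprox : StrictDerivApprox K x ε :=
    ⟨_, (hKdiff.hasStrictDerivAt one_ne_zero).eventually_norm_sub_le hε⟩
  have hPapprox : StrictDerivApprox P x (c' - ε) := ⟨0, hPev⟩
  have hKP : ∀ y, K y + P y = F y := fun y => by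
    simp only [hK, hP, inversionSlash]; ring
  have hsum := hKapprox.add hPapprox
  simp only [hKP] at hsum
  rwa [add_sub_cancel] at hsum

lemma forall_of_inversion_contraction {E : ℝ → ℝ → Prop} {ρ c₀ : ℝ} (hρ0 : 0 < ρ) (hρ1 : ρ < 1)
    (hc₀ : 0 < c₀) (hmono : ∀ x c c', c ≤ c' → E x c → E x c')
    (hshift : ∀ x c, ∀ n : ℤ, E (x - n) c → E x c) (hzero : ∀ c, 0 < c → E 0 c)
    (hstep : ∀ x c, x ≠ 0 → |x| ≤ 1 / 2 → 0 < c → E (-x⁻¹) c → E x (ρ * c))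
    (hstart : ∀ x, E x c₀) (c : ℝ) (hc : 0 < c) (x : ℝ) : E x c := by
  have key : ∀ n : ℕ, ∀ x, E x (ρ ^ n * c₀) := by
    intro n
    induction n with
    | zero => simpa using hstart
    | succ n ih =>
      intro x
      refine hshift x _ (round x) ?_
      rcases eq_or_ne (x - round x) 0 with h | h
      · rw [h]
        exact hzero _ (by positivity)
      · rw [pow_succ', mul_assoc]
        exact hstep _ _ h (abs_sub_round x) (by positivity) (ih _)
  obtain ⟨n, hn⟩ := exists_pow_lt_of_lt_one (div_pos hc hc₀) hρ1
  exact hmono _ _ _ ((lt_div_iff₀ hc₀).1 hn).le (key n x)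

lemma exists_tendsto_of_forall_approx {α : Type*} {l : Filter α} [l.NeBot] {g : α → ℂ}
    (h : ∀ c : ℝ, 0 < c → ∃ a : ℂ, ∀ᶠ p in l, ‖g p - a‖ ≤ c) : ∃ a, Tendsto g l (𝓝 a) := by
  refine cauchy_map_iff_exists_tendsto.1 (Metric.cauchy_iff.2 ⟨inferInstance, fun ε hε => ?_⟩)
  obtain ⟨a, ha⟩ := h (ε / 3) (by linarith)
  refine ⟨Metric.closedBall a (ε / 3), ?_, fun y hy z hz => ?_⟩
  · rw [Filter.mem_map]
    filter_upwards [ha] with p hp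
    rwa [mem_preimage, mem_closedBall_iff_norm]
  · have := dist_triangle_right y z a
    rw [Metric.mem_closedBall] at hy hz
    linarith

lemma contDiff_one_of_strictDerivApprox {F : ℝ → ℂ}
    (h : ∀ c, 0 < c → ∀ x, StrictDerivApprox F x c) : ContDiff ℝ 1 F := by
  have hdiff : Differentiable ℝ F := by
    intro x
    obtain ⟨a, ha⟩ := exists_tendsto_of_forall_approx (l := 𝓝[≠] x) (g := slope F x) fun c hc => by
      obtain ⟨a, ha⟩ := h c hc x
      refine ⟨a, ?_⟩
      have hpair : Tendsto (fun y : ℝ => (y, x)) (𝓝[≠] x) (𝓝 (x, x)) :=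
        (Continuous.tendsto (by fun_prop) x).mono_left nhdsWithin_le_nhds
      filter_upwards [hpair.eventually ha, self_mem_nhdsWithin] with y hy hne
      have hpos : 0 < |y - x| := abs_pos.2 (sub_ne_zero.2 hne)
      have hne' : ((y : ℂ) - x) ≠ 0 := by exact_mod_cast sub_ne_zero.2 hne
      have hmul : F y - F x - ((y - x : ℝ) : ℂ) * a = ((y - x : ℝ) : ℂ) * (slope F x y - a) := by
        rw [slope_def_module, Complex.real_smul]
        push_cast
        field_simp
      simp only [hmul, norm_mul, Complex.norm_real, Real.norm_eq_abs] at hy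
      nlinarith
    exact (hasDerivAt_iff_tendsto_slope.2 ha).differentiableAt
  refine contDiff_one_iff_deriv.2 ⟨hdiff, continuous_iff_continuousAt.2 fun x => ?_⟩
  rw [ContinuousAt, Metric.tendsto_nhds]
  intro ε hε
  obtain ⟨a, ha⟩ := h (ε / 3) (by linarith) x
  have hdiag : Tendsto (fun y : ℝ => (y, y)) (𝓝 x) (𝓝 (x, x)) :=
    Continuous.tendsto (by fun_prop) x
  have hclose : ∀ᶠ y in 𝓝 x, ‖deriv F y - a‖ ≤ ε / 3 := by
    filter_upwards [hdiag.eventually (eventually_eventually_nhds.2 ha)] with y hy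
    have hG : HasDerivAt (fun z : ℝ => F z - (z : ℂ) * a) (deriv F y - a) y := by
      have := (hdiff y).hasDerivAt.fun_sub ((hasDerivAt_id y).ofReal_comp.mul_const a)
      simpa using this
    refine hG.le_of_lip' (by linarith) ?_
    have hpair : Tendsto (fun z : ℝ => (z, y)) (𝓝 y) (𝓝 (y, y)) :=
      Continuous.tendsto (by fun_prop) y
    filter_upwards [hpair.eventually hy] with z hz
    have heq : F z - z * a - (F y - y * a) = F z - F y - ((z - y : ℝ) : ℂ) * a := by
      push_cast
      ring
    rw [heq]
    exact hz
  filter_upwards [hclose] with y hy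
  have hx := hclose.self_of_nhds
  rw [dist_eq_norm]
  have : deriv F y - deriv F x = (deriv F y - a) - (deriv F x - a) := by ring
  rw [this]
  linarith [norm_sub_le (deriv F y - a) (deriv F x - a)]

lemma contDiff_one_of_inversion {κ : ℂ} (hκ : 2 < κ.re) {F : ℝ → ℂ} (hF : Continuous F)
    (hper : F.Periodic 1)
    (hreg : ContDiffOn ℝ 1 (fun x => F x - inversionSlash κ F x) (Ioo (-1) 1)) :
    ContDiff ℝ 1 F := by
  obtain ⟨B, hB⟩ := exists_norm_le_of_periodic hF hper
  obtain ⟨L, hL0, hL⟩ := exists_lipschitz_of_contDiffOn hκ hF hper hreg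
  have hat : ∀ x ∈ Ioo (-1 : ℝ) 1, ContDiffAt ℝ 1 (fun x => F x - inversionSlash κ F x) x :=
    fun x hx => hreg.contDiffAt (isOpen_Ioo.mem_nhds hx)
  refine contDiff_one_of_strictDerivApprox (forall_of_inversion_contraction
    (ρ := (3 / 4 : ℝ) ^ (κ.re - 2)) (c₀ := L + 1) (by positivity)
    (Real.rpow_lt_one (by norm_num) (by norm_num) (by linarith)) (by linarith) ?_ ?_ ?_ ?_ ?_)
  · rintro x c c' hcc ⟨a, ha⟩
    exact ⟨a, ha.mono fun p hp => hp.trans (by gcongr)⟩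
  · rintro x c n ⟨a, ha⟩
    refine ⟨a, ?_⟩
    have hsub : Tendsto (fun p : ℝ × ℝ => (p.1 - n, p.2 - n)) (𝓝 (x, x)) (𝓝 (x - n, x - n)) :=
      Continuous.tendsto (by fun_prop) (x, x)
    have hFn : ∀ y, F (y - n) = F y := fun y => by simpa using hper.sub_int_mul_eq (x := y) n
    filter_upwards [hsub.eventually ha] with p hp
    simpa [hFn] using hp
  · exact fun c hc => strictDerivApprox_zero hκ hB hL0 hL (hat 0 (by norm_num)) hc
  · intro x c hx hx2 hc hE
    refine strictDerivApprox_step hκ hF hx (hat x (abs_lt.1 (hx2.trans_lt (by norm_num)))) ?_ hE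
    exact mul_lt_mul_of_pos_right (Real.rpow_lt_rpow (abs_nonneg x)
      (hx2.trans_lt (by norm_num)) (by linarith)) hc
  · refine fun x => ⟨0, Eventually.of_forall fun p => ?_⟩
    rw [mul_zero, sub_zero]
    nlinarith [hL p.1 p.2, abs_nonneg (p.1 - p.2)]

/-- A continuous periodic function is `C^j` as soon as its period function is `C^j` and the
weight is large enough. -/
theorem contDiff_of_inversion (j : ℕ) : ∀ {κ : ℂ} {F : ℝ → ℂ}, 2 * (j : ℝ) < κ.re →
    Continuous F → F.Periodic 1 →
    ContDiffOn ℝ j (fun x => F x - inversionSlash κ F x) (Ioo (-1) 1) → ContDiff ℝ j F := by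
  induction j with
  | zero =>
    intro κ F _ hF _ _
    simpa using hF
  | succ j ih =>
    intro κ F hκ hF hper hreg
    push_cast at hκ hreg ⊢
    have hj : (0 : ℝ) ≤ j := j.cast_nonneg
    have hκ2 : 2 * (j : ℝ) < (κ - 2).re := by
      simp only [Complex.sub_re, Complex.re_ofNat]; linarith
    obtain ⟨B, hB⟩ := exists_norm_le_of_periodic hF hper
    have hFj : ContDiff ℝ j F := ih (by linarith) hF hper (hreg.of_le (by simp))
    have hF1 : ContDiff ℝ 1 F :=
      contDiff_one_of_inversion (κ := κ) (by linarith) hF hper (hreg.of_le (by simp))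
    obtain ⟨hdiff, hcont⟩ := contDiff_one_iff_deriv.1 hF1
    refine contDiff_succ_iff_deriv.2 ⟨hdiff, by simp, ih hκ2 hcont (deriv_periodic hper) ?_⟩
    have hd := hasDerivAt_inversionSlash (κ := κ) (by linarith) hB hdiff
    have heq : (fun x => deriv F x - inversionSlash (κ - 2) (deriv F) x) = fun x =>
        deriv (fun x => F x - inversionSlash κ F x) x +
          κ * (x * inversionSlash (κ - 2) F x) := by
      funext x
      rw [((hdiff x).hasDerivAt.fun_sub (hd x)).deriv]
      ring
    rw [heq]
    refine ((contDiffOn_succ_iff_deriv_of_isOpen isOpen_Ioo).1 hreg).2.2.add ?_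
    exact (contDiff_const.mul (Complex.ofRealCLM.contDiff.mul
      (contDiff_inversionSlash j hκ2 hFj hper))).contDiffOn

lemma den_neg_inv_lt {x : ℚ} (hx : x ≠ 0) (hx1 : |x| < 1) : (-x⁻¹).den < x.den := by
  rw [Rat.neg_den, Rat.den_inv_of_ne_zero hx]
  rw [← Rat.num_div_den x, abs_div, div_lt_one (by simpa using x.den_pos)] at hx1
  zify
  have h : (|(x.num : ℚ)| : ℚ) < x.den := by simpa using hx1
  exact_mod_cast h

lemma periodic_sub_intCast {f : ℚ → ℂ} (hper : f.Periodic 1) (x : ℚ) (n : ℤ) : f (x - n) = f x := by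
  simpa using hper.sub_int_mul_eq (x := x) n

lemma exists_norm_le_of_rat_inversion {κ : ℂ} (hκ : 0 < κ.re) {f : ℚ → ℂ} {h : ℝ → ℂ}
    (hper : f.Periodic 1)
    (hrec : ∀ x : ℚ, x ≠ 0 → f x = h x + ((|(x : ℝ)| : ℝ) : ℂ) ^ κ * f (-x⁻¹))
    (hcont : ContinuousOn h (Icc (-1) 1)) (h0 : h 0 = f 0) : ∃ B, ∀ x, ‖f x‖ ≤ B := by
  obtain ⟨H, hH⟩ := isCompact_Icc.exists_bound_of_continuousOn hcont
  set ρ : ℝ := (1 / 2 : ℝ) ^ κ.re with hρ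
  have hρ0 : 0 ≤ ρ := by positivity
  have hρ1 : ρ < 1 := Real.rpow_lt_one (by norm_num) (by norm_num) hκ
  have hH0 : 0 ≤ H := (norm_nonneg _).trans (hH 0 (by norm_num))
  have hB : H + ρ * (H / (1 - ρ)) = H / (1 - ρ) := by
    have : 1 - ρ ≠ 0 := by linarith
    field_simp
    ring
  have hB0 : 0 ≤ H / (1 - ρ) := div_nonneg hH0 (by linarith)
  refine ⟨H / (1 - ρ), ?_⟩
  suffices key : ∀ n : ℕ, ∀ x : ℚ, x.den = n → ‖f x‖ ≤ H / (1 - ρ) from fun x => key _ x rfl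
  intro n
  induction n using Nat.strong_induction_on with
  | _ n ih =>
    intro x hxn
    rw [← periodic_sub_intCast hper x (round x)]
    have hden : (x - round x).den = n := by rw [Rat.sub_intCast_den, hxn]
    have habs : |x - round x| ≤ 1 / 2 := abs_sub_round x
    generalize x - round x = y at hden habs
    have habsR : |(y : ℝ)| ≤ 1 / 2 := by
      rw [← Rat.cast_abs]
      simpa using (Rat.cast_le (K := ℝ)).2 habs
    rcases eq_or_ne y 0 with rfl | hy
    · rw [← h0]
      have := hH 0 (by norm_num)
      nlinarith [mul_nonneg hρ0 hB0]
    · rw [hrec y hy]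
      refine (norm_add_le _ _).trans (le_trans (add_le_add (hH _ ?_) ?_) hB.le)
      · exact abs_le.1 (habsR.trans (by norm_num))
      · rw [norm_mul, norm_abs_cpow hκ]
        refine mul_le_mul ?_ (ih _ ?_ _ rfl) (norm_nonneg _) hρ0
        · exact Real.rpow_le_rpow (abs_nonneg _) habsR hκ.le
        · rw [← hden]
          exact den_neg_inv_lt hy (habs.trans_lt (by norm_num))

lemma exists_tendsto_of_rat_inversion {κ : ℂ} (hκ : 0 < κ.re) {f : ℚ → ℂ} {h : ℝ → ℂ}
    (hper : f.Periodic 1)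
    (hrec : ∀ x : ℚ, x ≠ 0 → f x = h x + ((|(x : ℝ)| : ℝ) : ℂ) ^ κ * f (-x⁻¹))
    (hcont : ContinuousOn h (Icc (-1) 1)) (h0 : h 0 = f 0) (x : ℝ) :
    ∃ a, Tendsto f (comap ((↑) : ℚ → ℝ) (𝓝 x)) (𝓝 a) := by
  obtain ⟨B, hB⟩ := exists_norm_le_of_rat_inversion hκ hper hrec hcont h0
  have hB0 : 0 ≤ B := (norm_nonneg _).trans (hB 0)
  have hat : ∀ x : ℝ, |x| < 1 → ContinuousAt h x := fun x hx =>
    hcont.continuousAt (Icc_mem_nhds (abs_lt.1 hx).1 (abs_lt.1 hx).2)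
  have := Rat.isDenseEmbedding_coe_real.isDenseInducing.comap_nhds_neBot x
  refine exists_tendsto_of_forall_approx fun c hc => ?_
  refine forall_of_inversion_contraction
    (E := fun x c => ∃ a : ℂ, ∀ᶠ y : ℚ in comap ((↑) : ℚ → ℝ) (𝓝 x), ‖f y - a‖ ≤ c)
    (ρ := (3 / 4 : ℝ) ^ κ.re) (c₀ := B + 1) (by positivity)
    (Real.rpow_lt_one (by norm_num) (by norm_num) hκ) (by linarith) ?_ ?_ ?_ ?_ ?_ c hc x
  · rintro x c c' hcc ⟨a, ha⟩
    exact ⟨a, ha.mono fun p hp => hp.trans hcc⟩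
  · rintro x c n ⟨a, ha⟩
    have hsub : Tendsto (fun y : ℚ => y - (n : ℚ)) (comap ((↑) : ℚ → ℝ) (𝓝 x))
        (comap ((↑) : ℚ → ℝ) (𝓝 (x - n))) := by
      rw [tendsto_comap_iff]
      simpa [Function.comp_def] using
        (tendsto_comap (f := ((↑) : ℚ → ℝ)) (x := 𝓝 x)).sub_const (n : ℝ)
    refine ⟨a, ?_⟩
    filter_upwards [hsub.eventually ha] with y hy
    rwa [periodic_sub_intCast hper] at hy
  · intro c hc
    have hlim : Tendsto (fun y : ℝ => ‖h y - h 0‖ + |y| ^ κ.re * B) (𝓝 0) (𝓝 0) := by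
      have h1 : Tendsto (fun y : ℝ => ‖h y - h 0‖) (𝓝 0) (𝓝 ‖h 0 - h 0‖) :=
        ((hat 0 (by norm_num)).tendsto.sub_const _).norm
      have h2 : Tendsto (fun y : ℝ => |y| ^ κ.re * B) (𝓝 0) (𝓝 (|0| ^ κ.re * B)) :=
        ((continuous_abs.rpow_const fun _ => Or.inr hκ.le).mul continuous_const).tendsto 0
      simpa [Real.zero_rpow hκ.ne'] using h1.add h2
    refine ⟨h 0, ?_⟩
    filter_upwards [tendsto_comap.eventually (hlim.eventually (gt_mem_nhds hc))] with y hy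
    rcases eq_or_ne y 0 with rfl | hy0
    · simpa [h0] using hc.le
    · have hsplit : f y - h 0 = (h y - h 0) + ((|(y : ℝ)| : ℝ) : ℂ) ^ κ * f (-y⁻¹) := by
        rw [hrec y hy0]; ring
      rw [hsplit]
      refine (norm_add_le _ _).trans (le_trans (add_le_add_right ?_ _) hy.le)
      rw [norm_mul, norm_abs_cpow hκ]
      gcongr
      exact hB _
  · rintro x c hx hx2 hc ⟨a, ha⟩
    have hinv : Tendsto (fun y : ℚ => -y⁻¹) (comap ((↑) : ℚ → ℝ) (𝓝 x))
        (comap ((↑) : ℚ → ℝ) (𝓝 (-x⁻¹))) := by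
      rw [tendsto_comap_iff]
      simpa [Function.comp_def] using
        ((tendsto_comap (f := ((↑) : ℚ → ℝ)) (x := 𝓝 x)).inv₀ hx).neg
    set p : ℝ → ℂ := fun y => ((|y| : ℝ) : ℂ) ^ κ with hp
    have hlim : Tendsto (fun y : ℝ => ‖h y - h x‖ + ‖p y - p x‖ * ‖a‖ + |y| ^ κ.re * c) (𝓝 x)
        (𝓝 (|x| ^ κ.re * c)) := by
      have h1 : Tendsto (fun y : ℝ => ‖h y - h x‖) (𝓝 x) (𝓝 ‖h x - h x‖) :=
        ((hat x (hx2.trans_lt (by norm_num))).tendsto.sub_const _).norm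
      have h2 : Tendsto (fun y : ℝ => ‖p y - p x‖ * ‖a‖) (𝓝 x) (𝓝 (‖p x - p x‖ * ‖a‖)) :=
        ((continuousAt_abs_cpow hx κ).tendsto.sub_const _).norm.mul_const _
      have h3 : Tendsto (fun y : ℝ => |y| ^ κ.re * c) (𝓝 x) (𝓝 (|x| ^ κ.re * c)) :=
        ((continuous_abs.rpow_const fun _ => Or.inr hκ.le).mul continuous_const).tendsto x
      simpa using (h1.add h2).add h3
    have hlt : |x| ^ κ.re * c < (3 / 4 : ℝ) ^ κ.re * c :=
      mul_lt_mul_of_pos_right (Real.rpow_lt_rpow (abs_nonneg x)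
        (hx2.trans_lt (by norm_num)) hκ) hc
    refine ⟨h x + p x * a, ?_⟩
    filter_upwards [tendsto_comap.eventually (hlim.eventually (gt_mem_nhds hlt)),
      hinv.eventually ha, tendsto_comap.eventually (isOpen_ne.mem_nhds hx)] with y hy hya hy0
    have hy0 : y ≠ 0 := by exact_mod_cast hy0
    have hsplit : f y - (h x + p x * a) =
        (h y - h x) + (p y - p x) * a + p y * (f (-y⁻¹) - a) := by
      rw [hrec y hy0]; ring
    rw [hsplit]
    refine (norm_add₃_le).trans (le_trans ?_ hy.le)
    rw [norm_mul, norm_mul, norm_abs_cpow hκ]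
    gcongr
  · exact fun x => ⟨0, Eventually.of_forall fun y => by rw [sub_zero]; linarith [hB y]⟩

/-- If `Re k < 0`, `m < |Re k|/2`, the period function `h` is `C^m` on
`[-1,1]` and `h 0 = f 0`, then the extension `f†` of the quantum modular form `f` to `ℝ`
is `m` times continuously differentiable. -/
theorem stmt1 (k : ℂ) (hk : k.re < 0) (m : ℕ) (hm : (m : ℝ) < |k.re| / 2)
    (f : ℚ → ℂ) (h : ℝ → ℂ)
    (hper : ∀ x : ℚ, f (x + 1) = f x)
    (hrec : ∀ x : ℚ, x ≠ 0 →
      f x - ((|((x : ℚ) : ℝ)| : ℝ) : ℂ) ^ (-k) * f (-1 / x) = h x)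
    (hreg : ContDiffOn ℝ m h (Set.Icc (-1 : ℝ) 1))
    (h0 : h 0 = f 0) :
    ∃ fd : ℝ → ℂ,
      (∀ y : ℚ, fd (y : ℝ) = f y) ∧
      (∀ x : ℝ, Irrational x →
        Tendsto (fun y : ℚ => f y) (Filter.comap ((↑) : ℚ → ℝ) (nhds x)) (nhds (fd x))) ∧
      ContDiff ℝ m fd := by
  have hκ : 0 < (-k).re := by simpa using hk
  have hrec' : ∀ x : ℚ, x ≠ 0 → f x = h x + ((|(x : ℝ)| : ℝ) : ℂ) ^ (-k) * f (-x⁻¹) := by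
    intro x hx
    rw [← hrec x hx, neg_div, one_div]
    ring
  have hdi := Rat.isDenseEmbedding_coe_real.isDenseInducing
  have hlim := exists_tendsto_of_rat_inversion hκ hper hrec' hreg.continuousOn h0
  choose F hF using hlim
  have hFeq : hdi.extend f = F := funext fun x => hdi.extend_eq_of_tendsto (hF x)
  have hFcont : Continuous F := hFeq ▸ hdi.continuous_extend fun x => ⟨F x, hF x⟩
  have hFrat : ∀ y : ℚ, F y = f y := by
    intro y
    have hpure : Tendsto f (pure y) (𝓝 (F y)) :=
      (hF y).mono_left (by
        rw [← tendsto_iff_comap]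
        exact tendsto_pure_left.2 fun s hs => mem_of_mem_nhds hs)
    exact tendsto_nhds_unique hpure (tendsto_pure_nhds f y)
  have hdense : DenseRange ((↑) : ℚ → ℝ) := Rat.isDenseEmbedding_coe_real.dense
  have hFper : F.Periodic 1 := by
    have : (fun x => F (x + 1)) = F :=
      hdense.equalizer (by fun_prop) hFcont (funext fun y => by
        have := hFrat (y + 1)
        push_cast at this
        simp [this, hFrat, hper])
    exact fun x => congrFun this x
  have hFh : ∀ x ∈ Ioo (-1 : ℝ) 1, F x - inversionSlash (-k) F x = h x := by
    intro x hx
    obtain ⟨B, hB⟩ := exists_norm_le_of_periodic hFcont hFper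
    have := hdi.comap_nhds_neBot x
    have hl : Tendsto (fun y : ℚ => F y - inversionSlash (-k) F y)
        (comap ((↑) : ℚ → ℝ) (𝓝 x)) (𝓝 (F x - inversionSlash (-k) F x)) :=
      ((hFcont.sub (continuous_inversionSlash hκ hFcont hB)).tendsto x).comp tendsto_comap
    have hr : Tendsto (fun y : ℚ => h y) (comap ((↑) : ℚ → ℝ) (𝓝 x)) (𝓝 (h x)) :=
      (hreg.continuousOn.continuousAt (Icc_mem_nhds hx.1 hx.2)).tendsto.comp tendsto_comap
    refine tendsto_nhds_unique (hl.congr fun y => ?_) hr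
    rcases eq_or_ne y 0 with rfl | hy
    · simp only [Rat.cast_zero, inversionSlash_zero hκ, h0, sub_zero]
      simpa using hFrat 0
    · have hinv : F (-(y : ℝ)⁻¹) = f (-y⁻¹) := by simpa using hFrat (-y⁻¹)
      rw [inversionSlash, hFrat, hinv, hrec' y hy]
      ring
  refine ⟨F, hFrat, fun x _ => hF x, contDiff_of_inversion m (κ := -k) ?_ hFcont hFper ?_⟩
  · rw [abs_of_neg hk] at hm
    simp only [Complex.neg_re]
    linarith
  · exact (hreg.mono Ioo_subset_Icc_self).congr hFh
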